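/- For every fixed n ≥ 0, the growth of Rⁿ(L(G)) is negligible compared to that of R∞: the quotient 𝔤_k(Rⁿ(L(G))) / 𝔤_k(R∞) tends to 0 as k → ∞ (note 𝔤_k(R∞) ≥ 1 for every k ≥ 0, since the power aᵏ lies in R∞). -/

import Mathlib

abbrev F2 := FreeGroup (Fin 2)

def CyclicallyReduced2 (w : F2) : Prop :=
  ∀ x ∈ w.toWord.head?, ∀ y ∈ w.toWord.getLast?, x ≠ (y.1, !y.2)

/-- `u` occurs as a cyclic subword of `w`. -/
def CyclicSubword2 (u : List (Fin 2 × Bool)) (w : F2) : Prop :=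
  u.length ≤ w.toWord.length ∧ u <:+: (w.toWord ++ w.toWord)

def lA : Fin 2 × Bool := (0, true)
def lAi : Fin 2 × Bool := (0, false)
def lB : Fin 2 × Bool := (1, true)
def lBi : Fin 2 × Bool := (1, false)

/-- The set `G` of elements satisfying Goldstein's criterion with `x = b⁻¹`, `y = a`. -/
def GSet : Set F2 :=
  {w | CyclicallyReduced2 w ∧ ¬ CyclicSubword2 [lAi, lBi] w ∧ ¬ CyclicSubword2 [lBi, lAi] w ∧
    ¬ CyclicSubword2 [lBi, lBi] w}

def phiHom : F2 →* F2 :=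
  FreeGroup.lift (fun i => if i = 0 then FreeGroup.of 0 else FreeGroup.of 1 * FreeGroup.of 0)

def phiInvHom : F2 →* F2 :=
  FreeGroup.lift (fun i => if i = 0 then FreeGroup.of 0 else FreeGroup.of 1 * (FreeGroup.of 0)⁻¹)

/-- The automorphism `φ : a ↦ a, b ↦ b·a`. -/
def phi : F2 ≃* F2 :=
  MonoidHom.toMulEquiv phiHom phiInvHom
    (by apply FreeGroup.ext_hom; intro x; fin_cases x <;>
        simp [phiHom, phiInvHom, mul_assoc])
    (by apply FreeGroup.ext_hom; intro x; fin_cases x <;>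
        simp [phiHom, phiInvHom, mul_assoc])

/-- The automorphism `γ` swapping `a` and `b`. -/
def gam : F2 ≃* F2 := FreeGroup.freeGroupCongr (Equiv.swap 0 1)

def ROp (S : Set F2) : Set F2 := {w | w ∈ GSet ∧ phi w ∈ S}
def LOp (S : Set F2) : Set F2 := {w | w ∈ GSet ∧ gam (phi w) ∈ S}

noncomputable def growth2 (S : Set F2) (n : ℕ) : ℕ :=
  Nat.card {w : F2 // w ∈ S ∧ FreeGroup.norm w = n}

/-- The set `R∞`. -/
def Rinf : Set F2 :=
  {w | CyclicallyReduced2 w ∧ ¬ CyclicSubword2 [lAi, lBi] w ∧ ¬ CyclicSubword2 [lBi, lAi] w ∧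
    ∀ k : ℕ, ¬ CyclicSubword2 ([lBi] ++ List.replicate k lA ++ [lBi]) w}


set_option linter.unusedSimpArgs false

/-! ### The action of `phi` on reduced words -/

abbrev Lt := Fin 2 × Bool

/-- allowed consecutive letters in a word of `GSet` -/
def gr (x y : Lt) : Prop :=
  (x.1 = y.1 → x.2 = y.2) ∧ ¬ (x = lAi ∧ y = lBi) ∧ ¬ (x = lBi ∧ y = lAi) ∧ ¬ (x = lBi ∧ y = lBi)

theorem GSet_chain {w : F2} (h : w ∈ GSet) : List.IsChain gr w.toWord := by
  obtain ⟨-, h1, h2, h3⟩ := h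
  have hr : FreeGroup.IsReduced w.toWord := FreeGroup.isReduced_toWord
  rw [FreeGroup.IsReduced, List.isChain_iff_forall_rel_of_append_cons_cons] at hr
  rw [List.isChain_iff_forall_rel_of_append_cons_cons]
  intro x y u v huv
  have key : CyclicSubword2 [x, y] w := by
    refine ⟨by rw [huv]; simp; omega, ?_⟩
    have : [x, y] <:+: w.toWord := ⟨u, v, by rw [huv]; simp⟩
    exact this.trans (List.prefix_append _ _).isInfix
  refine ⟨hr huv, ?_, ?_, ?_⟩
  · rintro ⟨rfl, rfl⟩; exact h1 key
  · rintro ⟨rfl, rfl⟩; exact h2 key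
  · rintro ⟨rfl, rfl⟩; exact h3 key

/-- A transducer computing the reduced word of `phi`; the flag says that a letter `a` is pending. -/
def T : Bool → List Lt → List Lt
  | p, [] => if p then [lA] else []
  | p, (i, e) :: l =>
    if i = 0 then
      (if e then (if p then lA :: T true l else T true l)
        else (if p then T false l else lAi :: T false l))
    else
      (if e then (if p then lA :: lB :: T true l else lB :: T true l)
        else (if p then lBi :: T false l else lAi :: lBi :: T false l))

theorem T_mk (l : List Lt) : ∀ p, FreeGroup.mk (T p l) =
    (if p then FreeGroup.of 0 else 1) * phi (FreeGroup.mk l) := by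
  have hA : ∀ l, FreeGroup.mk (lA :: l) = FreeGroup.of (0 : Fin 2) * FreeGroup.mk l := fun l => rfl
  have hB : ∀ l, FreeGroup.mk (lB :: l) = FreeGroup.of (1 : Fin 2) * FreeGroup.mk l := fun l => rfl
  have hAi : ∀ l, FreeGroup.mk (lAi :: l) = (FreeGroup.of (0 : Fin 2))⁻¹ * FreeGroup.mk l :=
    fun l => rfl
  have hBi : ∀ l, FreeGroup.mk (lBi :: l) = (FreeGroup.of (1 : Fin 2))⁻¹ * FreeGroup.mk l :=
    fun l => rfl
  have h0 : phi (FreeGroup.of 0) = FreeGroup.of 0 := by simp [phi, phiHom]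
  have h1 : phi (FreeGroup.of 1) = FreeGroup.of 1 * FreeGroup.of 0 := by simp [phi, phiHom]
  induction l with
  | nil =>
    have : FreeGroup.mk ([] : List Lt) = 1 := rfl
    intro p; cases p <;> simp [T, this, hA]
  | cons x l ih =>
    have ihf := ih false
    have iht := ih true
    simp only [if_true, if_false, Bool.false_eq_true, one_mul] at ihf iht
    rcases x with ⟨i, e⟩
    fin_cases i <;> cases e
    · change ∀ p, _ = _ * phi (FreeGroup.mk (lAi :: l))
      intro p; cases p <;> simp [T, hA, hB, hAi, hBi, h0, h1, ihf, iht, mul_assoc]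
    · change ∀ p, _ = _ * phi (FreeGroup.mk (lA :: l))
      intro p; cases p <;> simp [T, hA, hB, hAi, hBi, h0, h1, ihf, iht, mul_assoc]
    · change ∀ p, _ = _ * phi (FreeGroup.mk (lBi :: l))
      intro p; cases p <;> simp [T, hA, hB, hAi, hBi, h0, h1, ihf, iht, mul_assoc]
    · change ∀ p, _ = _ * phi (FreeGroup.mk (lB :: l))
      intro p; cases p <;> simp [T, hA, hB, hAi, hBi, h0, h1, ihf, iht, mul_assoc]

theorem T_red_aux (l : List Lt) :
    (List.IsChain gr (lB :: l) → FreeGroup.IsReduced (lB :: T true l)) ∧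
    (List.IsChain gr (lA :: l) → FreeGroup.IsReduced (lA :: T true l)) ∧
    (List.IsChain gr (lA :: l) → FreeGroup.IsReduced (lBi :: T true l)) ∧
    (List.IsChain gr (lAi :: l) → FreeGroup.IsReduced (lB :: T false l)) ∧
    (List.IsChain gr (lAi :: l) → FreeGroup.IsReduced (lAi :: T false l)) ∧
    (List.IsChain gr (lBi :: l) → FreeGroup.IsReduced (lBi :: T false l)) := by
  induction l with
  | nil => simp [T, lA, lB, lAi, lBi]
  | cons x l ih =>
    obtain ⟨i1, i2, i3, i4, i5, i6⟩ := ih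
    rcases x with ⟨i, e⟩
    simp only [List.isChain_cons_cons]
    fin_cases i <;> cases e <;>
      simp_all [T, lA, lB, lAi, lBi, gr, FreeGroup.isReduced_cons_cons]

theorem T_red {l : List Lt} (h : List.IsChain gr l) : FreeGroup.IsReduced (T false l) := by
  cases l with
  | nil => simp [T]
  | cons x l =>
    obtain ⟨i1, i2, i3, i4, i5, i6⟩ := T_red_aux l
    rcases x with ⟨i, e⟩
    fin_cases i <;> cases e
    · exact i5 h
    · exact (i2 h).infix (List.suffix_cons _ _).isInfix
    · have := i6 h
      simp [T, lA, lB, lAi, lBi, FreeGroup.isReduced_cons_cons] at this ⊢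
      exact this
    · exact i1 h

theorem phi_toWord {w : F2} (h : w ∈ GSet) : (phi w).toWord = T false w.toWord := by
  have h1 := T_mk w.toWord false
  rw [FreeGroup.mk_toWord] at h1
  simp only [Bool.false_eq_true, if_false, one_mul] at h1
  rw [← h1, FreeGroup.toWord_mk, (T_red (GSet_chain h)).reduce_eq]

theorem T_append (u : List Lt) : ∀ p, ∃ q p', ∀ v, T p (u ++ v) = q ++ T p' v := by
  induction u with
  | nil => exact fun p => ⟨[], p, fun v => rfl⟩
  | cons x u ih =>
    intro p
    obtain ⟨qf, pf, hf⟩ := ih false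
    obtain ⟨qt, pt, ht⟩ := ih true
    rcases x with ⟨i, e⟩
    fin_cases i <;> cases e <;> cases p
    · exact ⟨lAi :: qf, pf, fun v => by simp [T, hf]⟩
    · exact ⟨qf, pf, fun v => by simp [T, hf]⟩
    · exact ⟨qt, pt, fun v => by simp [T, ht]⟩
    · exact ⟨lA :: qt, pt, fun v => by simp [T, ht]⟩
    · exact ⟨lAi :: lBi :: qf, pf, fun v => by simp [T, hf]⟩
    · exact ⟨lBi :: qf, pf, fun v => by simp [T, hf]⟩
    · exact ⟨lB :: qt, pt, fun v => by simp [T, ht]⟩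
    · exact ⟨lA :: lB :: qt, pt, fun v => by simp [T, ht]⟩

theorem T_rep_ai (k : ℕ) (v : List Lt) :
    T false (List.replicate k lAi ++ v) = List.replicate k lAi ++ T false v := by
  induction k with
  | zero => rfl
  | succ k ih => rw [List.replicate_succ, List.cons_append, List.cons_append, ← ih]; rfl

theorem T_rep_a (k : ℕ) (v : List Lt) :
    T true (List.replicate k lA ++ v) = List.replicate k lA ++ T true v := by
  induction k with
  | zero => rfl
  | succ k ih => rw [List.replicate_succ, List.cons_append, List.cons_append, ← ih]; rfl

theorem T_infix1 {l : List Lt} {k : ℕ} (h : (lB :: List.replicate (k + 1) lAi) <:+: l) :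
    (lB :: List.replicate k lAi) <:+: T false l := by
  obtain ⟨u, v, rfl⟩ := h
  obtain ⟨q, p, hq⟩ := T_append u false
  rw [List.append_assoc u, hq]
  have : ∃ r, T p (lB :: List.replicate (k + 1) lAi ++ v) =
      r ++ lB :: List.replicate k lAi ++ T false v := by
    have := T_rep_ai k v
    cases p
    · exact ⟨[], by rw [List.replicate_succ]; simp [T, lB, lAi] at this ⊢; exact this⟩
    · exact ⟨[lA], by rw [List.replicate_succ]; simp [T, lB, lAi] at this ⊢; exact this⟩
  obtain ⟨r, hr⟩ := this
  exact ⟨q ++ r, T false v, by rw [hr]; simp⟩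

theorem T_infix2 {l : List Lt} {k : ℕ}
    (h : ([lBi] ++ List.replicate (k + 1) lA ++ [lBi]) <:+: l) :
    ([lBi] ++ List.replicate k lA ++ [lBi]) <:+: T false l := by
  obtain ⟨u, v, rfl⟩ := h
  obtain ⟨q, p, hq⟩ := T_append u false
  rw [List.append_assoc u, hq]
  have : ∃ r, T p ([lBi] ++ List.replicate (k + 1) lA ++ [lBi] ++ v) =
      r ++ ([lBi] ++ List.replicate k lA ++ [lBi]) ++ T false v := by
    have := T_rep_a k (lBi :: v)
    cases p
    · exact ⟨[lAi], by
        rw [List.replicate_succ]; simp [T, lB, lAi, lBi, lA] at this ⊢; exact this⟩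
    · exact ⟨[], by
        rw [List.replicate_succ]; simp [T, lB, lAi, lBi, lA] at this ⊢; exact this⟩
  obtain ⟨r, hr⟩ := this
  exact ⟨q ++ r, T false v, by rw [hr]; simp⟩

theorem gam_toWord (w : F2) : (gam w).toWord = w.toWord.map fun x => (Equiv.swap 0 1 x.1, x.2) := by
  have h : gam w = FreeGroup.mk (w.toWord.map fun x => (Equiv.swap 0 1 x.1, x.2)) := by
    conv_lhs => rw [← FreeGroup.mk_toWord (x := w)]
    rfl
  rw [h, FreeGroup.toWord_mk]
  apply FreeGroup.IsReduced.reduce_eq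
  have hr : FreeGroup.IsReduced w.toWord := FreeGroup.isReduced_toWord
  unfold FreeGroup.IsReduced at hr ⊢
  rw [List.isChain_map]
  refine hr.imp ?_
  intro x y hxy h
  exact hxy ((Equiv.swap 0 1).injective h)

/-- linear forbidden subword conditions satisfied by `Rⁿ(L(G))` -/
def Good (n : ℕ) (l : List Lt) : Prop :=
  List.IsChain gr l ∧ ¬ (lB :: List.replicate (n + 3) lAi) <:+: l ∧
    ∀ j ≤ n, ¬ ([lBi] ++ List.replicate j lA ++ [lBi]) <:+: l

theorem chain_not {l : List Lt} (h : List.IsChain gr l) :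
    ¬ ([lBi] ++ List.replicate 0 lA ++ [lBi]) <:+: l := by
  intro h'
  have := h.infix h'
  simp [gr] at this

theorem RnL_good (n : ℕ) : ∀ w ∈ (ROp)^[n] (LOp GSet), w ∈ GSet ∧ Good n w.toWord := by
  induction n with
  | zero =>
    intro w hw
    obtain ⟨h1, h2⟩ := (hw : w ∈ GSet ∧ gam (phi w) ∈ GSet)
    have hc := GSet_chain h1
    refine ⟨h1, hc, ?_, ?_⟩
    · intro h
      have h3 := T_infix1 h
      rw [← phi_toWord h1] at h3
      have h4 := h3.map (fun x : Lt => ((Equiv.swap 0 1 x.1, x.2) : Lt))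
      rw [← gam_toWord] at h4
      have h5 := (GSet_chain h2).infix h4
      simp [gr, lAi, lBi, List.replicate_succ] at h5
    · intro j hj
      obtain rfl : j = 0 := by omega
      exact chain_not hc
  | succ n ih =>
    intro w hw
    rw [Function.iterate_succ_apply'] at hw
    obtain ⟨h1, h2⟩ := hw
    have hc := GSet_chain h1
    obtain ⟨-, -, h3, h4⟩ := ih _ h2
    rw [phi_toWord h1] at h3 h4
    refine ⟨h1, hc, fun h => h3 (T_infix1 h), ?_⟩
    intro j hj h
    cases j with
    | zero => exact chain_not hc h
    | succ j => exact h4 j (by omega) (T_infix2 h)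

/-! ### Counting words read by a partial automaton -/

section automata

variable {σ : Type}

def sel (a ai b bi : Option σ) (x : Lt) : Option σ :=
  if x.1 = 0 then (if x.2 then a else ai) else (if x.2 then b else bi)

def run (δ : σ → Lt → Option σ) : σ → List Lt → Option σ
  | s, [] => some s
  | s, x :: l => (δ s x).bind fun t => run δ t l

def wds (δ : σ → Lt → Option σ) (acc : σ → Bool) : ℕ → σ → Finset (List Lt)
  | 0, s => if acc s then {[]} else ∅
  | k + 1, s => Finset.univ.biUnion fun x : Lt =>
      ((δ s x).elim ∅ (wds δ acc k)).image (List.cons x)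

theorem mem_wds (δ : σ → Lt → Option σ) (acc : σ → Bool) (k : ℕ) : ∀ (s : σ) (l : List Lt),
    l ∈ wds δ acc k s ↔ l.length = k ∧ ∃ t, run δ s l = some t ∧ acc t = true := by
  induction k with
  | zero =>
    intro s l
    cases l with
    | nil => by_cases h : acc s <;> simp [wds, run, h]
    | cons x l => by_cases h : acc s <;> simp [wds, h]
  | succ k ih =>
    intro s l
    cases l with
    | nil => simp [wds]
    | cons x l =>
      simp only [wds, Finset.mem_biUnion, Finset.mem_univ, true_and, Finset.mem_image, run,
        List.length_cons, Nat.add_right_cancel_iff]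
      constructor
      · rintro ⟨y, m, hm, he⟩
        obtain ⟨rfl, rfl⟩ := List.cons.inj he
        cases hd : δ s y with
        | none => simp [hd] at hm
        | some t =>
          rw [hd] at hm
          simpa using (ih t m).1 hm
      · rintro ⟨hl, t, ht, hacc⟩
        refine ⟨x, l, ?_, rfl⟩
        cases hd : δ s x with
        | none => simp [hd] at ht
        | some t' =>
          rw [hd] at ht
          exact (ih t' l).2 ⟨hl, t, ht, hacc⟩

theorem card_wds_succ (δ : σ → Lt → Option σ) (acc : σ → Bool) (k : ℕ) (s : σ) :
    (wds δ acc (k + 1) s).card =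
      ∑ x : Lt, (δ s x).elim 0 (fun t => (wds δ acc k t).card) := by
  rw [wds, Finset.card_biUnion]
  · refine Finset.sum_congr rfl fun x _ => ?_
    rw [Finset.card_image_of_injective _ (List.cons_injective)]
    cases δ s x <;> rfl
  · intro x _ y _ hxy
    rw [Function.onFun, Finset.disjoint_left]
    intro l h1 h2
    simp only [Finset.mem_image] at h1 h2
    obtain ⟨m1, -, rfl⟩ := h1
    obtain ⟨m2, -, h⟩ := h2
    exact hxy (List.cons.inj h).1.symm

theorem wds_upper (δ : σ → Lt → Option σ) (acc : σ → Bool) (h : σ → ℝ) (x c : ℝ) (hx : 0 ≤ x)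
    (hc : 0 ≤ c) (hh : ∀ s, c ≤ h s) (hs : ∀ s, x * ∑ y : Lt, (δ s y).elim 0 h ≤ h s) (k : ℕ) :
    ∀ s, c * (wds δ acc k s).card * x ^ k ≤ h s := by
  induction k with
  | zero =>
    intro s
    have h1 : ((wds δ acc 0 s).card : ℝ) ≤ 1 := by
      rw [wds]; split_ifs <;> simp
    have := hh s
    rw [pow_zero, mul_one]
    nlinarith
  | succ k ih =>
    intro s
    refine le_trans ?_ (hs s)
    rw [card_wds_succ]
    push_cast
    rw [show c * (∑ y : Lt, (((δ s y).elim 0 (fun t => (wds δ acc k t).card) : ℕ) : ℝ)) * x ^ (k+1)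
      = x * ∑ y : Lt, c * (((δ s y).elim 0 (fun t => (wds δ acc k t).card) : ℕ) : ℝ) * x ^ k by
        rw [← Finset.sum_mul, ← Finset.mul_sum]; ring]
    refine mul_le_mul_of_nonneg_left (Finset.sum_le_sum fun y _ => ?_) hx
    cases δ s y with
    | none => simp
    | some t => exact ih t

theorem wds_lower (δ : σ → Lt → Option σ) (acc : σ → Bool) (h : σ → ℝ) (x : ℝ) (hx : 0 ≤ x)
    (hh : ∀ s, h s ≤ (wds δ acc 1 s).card) (hs : ∀ s, h s ≤ x * ∑ y : Lt, (δ s y).elim 0 h)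
    (k : ℕ) : ∀ s, h s ≤ (wds δ acc (k + 1) s).card * x ^ k := by
  induction k with
  | zero => intro s; simpa using hh s
  | succ k ih =>
    intro s
    refine le_trans (hs s) ?_
    rw [card_wds_succ δ acc (k + 1)]
    push_cast
    rw [show (∑ y : Lt, (((δ s y).elim 0 (fun t => (wds δ acc (k + 1) t).card) : ℕ) : ℝ))
        * x ^ (k+1)
      = x * ∑ y : Lt, (((δ s y).elim 0 (fun t => (wds δ acc (k + 1) t).card) : ℕ) : ℝ) * x ^ k by
        rw [← Finset.sum_mul]; ring]
    refine mul_le_mul_of_nonneg_left (Finset.sum_le_sum fun y _ => ?_) hx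
    cases δ s y with
    | none => simp
    | some t => exact ih t

theorem run_append (δ : σ → Lt → Option σ) (u v : List Lt) : ∀ s,
    run δ s (u ++ v) = (run δ s u).bind fun t => run δ t v := by
  induction u with
  | nil => intro s; rfl
  | cons x u ih =>
    intro s
    simp only [List.cons_append, run]
    cases δ s x with
    | none => rfl
    | some t => exact ih t

theorem run_sub (δ : σ → Lt → Option σ) {u l : List Lt} {s t : σ} (h : run δ s l = some t)
    (hu : u <:+: l) : ∃ s' t', run δ s' u = some t' := by
  obtain ⟨p, q, rfl⟩ := hu
  rw [List.append_assoc, run_append] at h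
  cases hp : run δ s p with
  | none => simp [hp] at h
  | some s' =>
    simp only [hp, Option.bind_some, run_append] at h
    cases hp' : run δ s' u with
    | none => simp [hp'] at h
    | some t' => exact ⟨s', t', hp'⟩

theorem sum_sel (a ai b bi : Option σ) (h : σ → ℝ) :
    ∑ y : Lt, (sel a ai b bi y).elim 0 h = a.elim 0 h + ai.elim 0 h + b.elim 0 h + bi.elim 0 h := by
  simp [Fintype.sum_prod_type, sel]
  ring

end automata

/-! ### Lower bound for `Rinf` -/

inductive LS : Type
  | B | P | M | I | Q

def Ld : LS → Lt → Option LS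
  | .B => sel (some .P) (some .M) (some .B) none
  | .P => sel (some .P) none (some .B) (some .I)
  | .M => sel none (some .M) (some .B) none
  | .I => sel (some .Q) none none none
  | .Q => sel (some .Q) none (some .B) none

def Lacc : LS → Bool
  | .I => false
  | _ => true

theorem Ld_card_one (s : LS) : 1 ≤ (wds Ld Lacc 1 s).card := by
  rw [Nat.one_le_iff_ne_zero, ← Nat.pos_iff_ne_zero, Finset.card_pos]
  cases s
  · exact ⟨[lB], (mem_wds _ _ _ _ _).2 ⟨rfl, .B, rfl, rfl⟩⟩
  · exact ⟨[lB], (mem_wds _ _ _ _ _).2 ⟨rfl, .B, rfl, rfl⟩⟩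
  · exact ⟨[lB], (mem_wds _ _ _ _ _).2 ⟨rfl, .B, rfl, rfl⟩⟩
  · exact ⟨[lA], (mem_wds _ _ _ _ _).2 ⟨rfl, .Q, rfl, rfl⟩⟩
  · exact ⟨[lB], (mem_wds _ _ _ _ _).2 ⟨rfl, .B, rfl, rfl⟩⟩

theorem Ld_pair (s : LS) (t : LS) (x y : Lt) (h : run Ld s [x, y] = some t) :
    (x.1 = y.1 → x.2 = y.2) ∧ ¬ (x = lAi ∧ y = lBi) ∧ ¬ (x = lBi ∧ y = lAi) := by
  rcases x with ⟨i, e⟩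
  rcases y with ⟨j, f⟩
  cases s <;> fin_cases i <;> cases e <;> fin_cases j <;> cases f <;>
    simp_all [run, Ld, sel, lA, lB, lAi, lBi]

theorem Ld_Q (k : ℕ) (s : LS) (hs : s = .I ∨ s = .Q) :
    run Ld s (List.replicate k lA ++ [lBi]) = none := by
  induction k generalizing s with
  | zero => rcases hs with rfl | rfl <;> rfl
  | succ k ih =>
    rw [List.replicate_succ, List.cons_append]
    rcases hs with rfl | rfl
    · exact ih .Q (Or.inr rfl)
    · exact ih .Q (Or.inr rfl)

theorem Ld_bad (k : ℕ) (s : LS) : run Ld s ([lBi] ++ List.replicate k lA ++ [lBi]) = none := by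
  rw [List.append_assoc, List.singleton_append]
  cases s
  case P => exact Ld_Q k .I (Or.inl rfl)
  all_goals rfl

theorem Ld_double {l : List Lt} {t : LS} (h : run Ld .B l = some t) (ht : Lacc t = true) :
    run Ld .B ((lB :: l) ++ (lB :: l)) = some t := by
  rw [run_append]
  have h1 : run Ld .B (lB :: l) = some t := h
  rw [h1]
  cases t
  case I => cases ht
  all_goals exact h

theorem Rinf_of_run {l : List Lt} {t : LS} (h : run Ld .B l = some t) (ht : Lacc t = true) :
    (FreeGroup.mk (lB :: l) : F2).toWord = lB :: l ∧ (FreeGroup.mk (lB :: l) : F2) ∈ Rinf := by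
  have hd := Ld_double h ht
  have hpair : ∀ x y, [x, y] <:+: (lB :: l) ++ (lB :: l) →
      (x.1 = y.1 → x.2 = y.2) ∧ ¬ (x = lAi ∧ y = lBi) ∧ ¬ (x = lBi ∧ y = lAi) := by
    intro x y hxy
    obtain ⟨s', t', h'⟩ := run_sub Ld hd hxy
    exact Ld_pair s' t' x y h'
  have hw : (FreeGroup.mk (lB :: l) : F2).toWord = lB :: l := by
    rw [FreeGroup.toWord_mk]
    apply FreeGroup.IsReduced.reduce_eq
    rw [FreeGroup.IsReduced, List.isChain_iff_forall_rel_of_append_cons_cons]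
    intro x y u v huv
    refine (hpair x y ?_).1
    have : [x, y] <:+: lB :: l := ⟨u, v, by rw [huv]; simp⟩
    exact this.trans (List.prefix_append _ _).isInfix
  refine ⟨hw, ?_, ?_, ?_, ?_⟩
  · rw [CyclicallyReduced2, hw]
    intro x hx y hy hxy
    obtain ⟨u, hu⟩ := List.getLast?_eq_some_iff.1 hy
    have hx' : lB = x := by simpa using hx
    subst hx'
    have := (hpair y lB ⟨u, l, by rw [hu]; simp [hu]⟩).1
    rw [hxy] at this
    simp at this
  · rintro ⟨-, h2⟩
    rw [hw] at h2
    exact (hpair _ _ h2).2.1 ⟨rfl, rfl⟩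
  · rintro ⟨-, h2⟩
    rw [hw] at h2
    exact (hpair _ _ h2).2.2 ⟨rfl, rfl⟩
  · rintro k ⟨-, h2⟩
    rw [hw] at h2
    obtain ⟨s', t', h'⟩ := run_sub Ld hd h2
    rw [Ld_bad] at h'
    cases h'

theorem growth_Rinf_ge (k : ℕ) : (wds Ld Lacc k .B).card ≤ growth2 Rinf (k + 1) := by
  have hfin : Finite {w : F2 // w ∈ Rinf ∧ FreeGroup.norm w = k + 1} := by
    have : Finite {l : List Lt // l.length = k + 1} := List.finite_length_eq Lt (k + 1)
    refine Finite.of_injective (β := {l : List Lt // l.length = k + 1})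
      (fun w => ⟨w.1.toWord, w.2.2⟩) ?_
    intro w v h
    exact Subtype.ext (FreeGroup.toWord_injective (congrArg Subtype.val h))
  have key : ∀ l ∈ wds Ld Lacc k .B, (FreeGroup.mk (lB :: l) : F2).toWord = lB :: l ∧
      (FreeGroup.mk (lB :: l) : F2) ∈ Rinf ∧
      FreeGroup.norm (FreeGroup.mk (lB :: l) : F2) = k + 1 := by
    intro l hl
    obtain ⟨hlen, t, h1, h2⟩ := (mem_wds _ _ _ _ _).1 hl
    obtain ⟨h3, h4⟩ := Rinf_of_run h1 h2
    exact ⟨h3, h4, by rw [FreeGroup.norm, h3]; simp [hlen]⟩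
  rw [growth2, ← Nat.card_eq_finsetCard]
  refine Nat.card_le_card_of_injective
    (fun l : wds Ld Lacc k .B => (⟨FreeGroup.mk (lB :: l.1), (key l.1 l.2).2⟩ :
      {w : F2 // w ∈ Rinf ∧ FreeGroup.norm w = k + 1})) ?_
  intro l m h
  have h1 := congrArg (fun w => FreeGroup.toWord w.1) h
  simp only [(key _ l.2).1, (key _ m.2).1] at h1
  exact Subtype.ext (List.cons.inj h1).2

/-! ### Upper bound for `Rⁿ(L(G))` -/

inductive US : Type
  | S | B | A | I
  | M (r : ℕ)
  | Q (r : ℕ)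

def Ud (n : ℕ) : US → Lt → Option US
  | .S => sel (some (.Q 0)) (some .A) (some .B) (some .I)
  | .B => sel (some (.Q 0)) (some (.M (n + 1))) (some .B) none
  | .A => sel none (some .A) (some .B) none
  | .I => sel (some (.Q n)) none none none
  | .M 0 => sel none none (some .B) none
  | .M (r + 1) => sel none (some (.M r)) (some .B) none
  | .Q 0 => sel (some (.Q 0)) none (some .B) (some .I)
  | .Q (r + 1) => sel (some (.Q r)) none (some .B) none

def ctx (n : ℕ) : US → List Lt
  | .S => []
  | .B => [lB]
  | .A => [lAi]
  | .I => [lBi]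
  | .M r => lB :: List.replicate (n + 2 - r) lAi
  | .Q 0 => [lA]
  | .Q (r + 1) => lBi :: List.replicate (n - r) lA

def valid (n : ℕ) : US → Prop
  | .M r => r ≤ n + 1
  | .Q r => r ≤ n
  | _ => True

theorem Good.mono {n : ℕ} {l m : List Lt} (h : Good n m) (hl : l <:+: m) : Good n l :=
  ⟨h.1.infix hl, fun h' => h.2.1 (h'.trans hl), fun j hj h' => h.2.2 j hj (h'.trans hl)⟩

theorem rep_last {k : ℕ} (hk : 0 < k) (c x : Lt) :
    [c, x] <:+: List.replicate k c ++ [x] := by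
  obtain ⟨k, rfl⟩ : ∃ j, k = j + 1 := ⟨k - 1, by omega⟩
  exact ⟨List.replicate k c, [], by rw [List.replicate_succ']; simp⟩

theorem Ud_step (n : ℕ) (s : US) (x : Lt) (hv : valid n s) (h : Good n (ctx n s ++ [x])) :
    ∃ t, Ud n s x = some t ∧ valid n t ∧ ctx n t <:+ ctx n s ++ [x] := by
  have hx : x = lA ∨ x = lAi ∨ x = lB ∨ x = lBi := by
    rcases x with ⟨i, e⟩
    fin_cases i <;> cases e <;> simp [lA, lAi, lB, lBi]
  have toB : x = lB → ∃ t, some US.B = some t ∧ valid n t ∧ ctx n t <:+ ctx n s ++ [x] := by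
    rintro rfl
    exact ⟨_, rfl, trivial, List.suffix_append _ _⟩
  have toI : x = lBi → ∃ t, some US.I = some t ∧ valid n t ∧ ctx n t <:+ ctx n s ++ [x] := by
    rintro rfl
    exact ⟨_, rfl, trivial, List.suffix_append _ _⟩
  have toA : x = lAi → ∃ t, some US.A = some t ∧ valid n t ∧ ctx n t <:+ ctx n s ++ [x] := by
    rintro rfl
    exact ⟨_, rfl, trivial, List.suffix_append _ _⟩
  have toQ : x = lA → ∃ t, some (US.Q 0) = some t ∧ valid n t ∧ ctx n t <:+ ctx n s ++ [x] := by
    rintro rfl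
    exact ⟨_, rfl, Nat.zero_le _, List.suffix_append _ _⟩
  have bad : ∀ c y, [c, y] <:+: ctx n s ++ [x] → ¬ gr c y → False := by
    intro c y hcy hg
    have := h.1.infix hcy
    simp at this
    exact hg this
  cases s with
  | S =>
    rcases hx with rfl | rfl | rfl | rfl
    · exact toQ rfl
    · exact toA rfl
    · exact toB rfl
    · exact toI rfl
  | B =>
    rcases hx with rfl | rfl | rfl | rfl
    · exact toQ rfl
    · exact ⟨.M (n + 1), rfl, le_refl _, by simp [ctx]⟩
    · exact toB rfl
    · exact (bad lB lBi (by simp [ctx]) (by simp [gr, lB, lBi])).elim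
  | A =>
    rcases hx with rfl | rfl | rfl | rfl
    · exact (bad lAi lA (by simp [ctx]) (by simp [gr, lA, lAi])).elim
    · exact toA rfl
    · exact toB rfl
    · exact (bad lAi lBi (by simp [ctx]) (by simp [gr, lAi, lBi])).elim
  | I =>
    rcases hx with rfl | rfl | rfl | rfl
    · refine ⟨.Q n, rfl, le_refl _, ?_⟩
      cases n with
      | zero => simp [ctx]
      | succ n => simp [ctx]
    · exact (bad lBi lAi (by simp [ctx]) (by simp [gr, lBi, lAi])).elim
    · exact (bad lBi lB (by simp [ctx]) (by simp [gr, lB, lBi])).elim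
    · exact (bad lBi lBi (by simp [ctx]) (by simp [gr, lBi])).elim
  | M r =>
    have hv' : r ≤ n + 1 := hv
    have hin : [lAi, x] <:+: ctx n (.M r) ++ [x] :=
      (rep_last (by omega) lAi x).trans (List.suffix_cons _ _).isInfix
    rcases hx with rfl | rfl | rfl | rfl
    · exact (bad lAi lA hin (by simp [gr, lA, lAi])).elim
    · cases r with
      | zero =>
        refine (h.2.1 ?_).elim
        rw [List.replicate_succ']
        exact List.infix_rfl
      | succ r =>
        refine ⟨.M r, rfl, by change r ≤ n + 1; omega, ?_⟩
        rw [ctx, ctx, show n + 2 - r = (n + 2 - (r + 1)) + 1 by omega, List.replicate_succ']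
        exact List.suffix_rfl
    · cases r <;> exact toB rfl
    · exact (bad lAi lBi hin (by simp [gr, lAi, lBi])).elim
  | Q r =>
    cases r with
    | zero =>
      rcases hx with rfl | rfl | rfl | rfl
      · exact toQ rfl
      · exact (bad lA lAi (by simp [ctx]) (by simp [gr, lA, lAi])).elim
      · exact toB rfl
      · exact toI rfl
    | succ r =>
      have hv' : r + 1 ≤ n := hv
      have hin : [lA, x] <:+: ctx n (.Q (r + 1)) ++ [x] :=
        (rep_last (by omega) lA x).trans (List.suffix_cons _ _).isInfix
      rcases hx with rfl | rfl | rfl | rfl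
      · refine ⟨.Q r, rfl, by change r ≤ n; omega, ?_⟩
        cases r with
        | zero => exact List.suffix_append _ _
        | succ r =>
          rw [ctx, ctx, show n - r = (n - (r + 1)) + 1 by omega, List.replicate_succ']
          exact List.suffix_rfl
      · exact (bad lA lAi hin (by simp [gr, lA, lAi])).elim
      · exact toB rfl
      · refine (h.2.2 (n - r) (by omega) ?_).elim
        exact List.infix_rfl

theorem Ud_run (n : ℕ) (l : List Lt) : ∀ s, valid n s → Good n (ctx n s ++ l) →
    ∃ t, run (Ud n) s l = some t := by
  induction l with
  | nil => intro s _ _; exact ⟨s, rfl⟩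
  | cons x l ih =>
    intro s hv h
    have h' : ctx n s ++ x :: l = ctx n s ++ [x] ++ l := by simp
    rw [h'] at h
    obtain ⟨t, ht, hvt, hc⟩ := Ud_step n s x hv (h.mono (List.prefix_append _ _).isInfix)
    have h2 : Good n (ctx n t ++ l) := by
      refine h.mono ?_
      obtain ⟨u, hu⟩ := hc
      exact ⟨u, [], by rw [← hu]; simp⟩
    obtain ⟨t', ht'⟩ := ih t hvt h2
    exact ⟨t', by rw [run, ht]; exact ht'⟩

theorem growth_RnL_le (n k : ℕ) :
    growth2 ((ROp)^[n] (LOp GSet)) k ≤ (wds (Ud n) (fun _ => true) k .S).card := by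
  rw [growth2, ← Nat.card_eq_finsetCard]
  refine Nat.card_le_card_of_injective
    (fun w : {w : F2 // w ∈ (ROp)^[n] (LOp GSet) ∧ FreeGroup.norm w = k} =>
      (⟨w.1.toWord, ?_⟩ : wds (Ud n) (fun _ => true) k .S)) ?_
  · rw [mem_wds]
    obtain ⟨t, ht⟩ := Ud_run n w.1.toWord .S trivial (RnL_good n _ w.2.1).2
    exact ⟨w.2.2, t, ht, rfl⟩
  · intro w v h
    exact Subtype.ext (FreeGroup.toWord_injective (congrArg Subtype.val h))

/-! ### Analysis -/

theorem exists_root : ∃ x : ℝ, 0.3 ≤ x ∧ x ≤ 0.4 ∧ 1 - 3 * x + x ^ 2 + x ^ 3 - x ^ 4 = 0 := by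
  have hc : ContinuousOn (fun x : ℝ => 1 - 3 * x + x ^ 2 + x ^ 3 - x ^ 4) (Set.Icc 0.3 0.4) := by
    fun_prop
  have := intermediate_value_Icc' (by norm_num) hc
  obtain ⟨x, hx, h⟩ := this (show (0 : ℝ) ∈ _ by constructor <;> norm_num)
  exact ⟨x, hx.1, hx.2, h⟩

noncomputable def Lh (x : ℝ) : LS → ℝ
  | .B => 1
  | .P => x / (1 - x) * (1 + x ^ 2 / (1 - x))
  | .M => x / (1 - x)
  | .I => x ^ 2 / (1 - x)
  | .Q => x / (1 - x)

theorem lower_bound {x : ℝ} (h1 : 0.3 ≤ x) (h2 : x ≤ 0.4)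
    (hx : 1 - 3 * x + x ^ 2 + x ^ 3 - x ^ 4 = 0) (k : ℕ) :
    1 ≤ (growth2 Rinf (k + 2) : ℝ) * x ^ k := by
  have hs : 0 < 1 - x := by linarith
  have hq : x / (1 - x) ≤ 2 / 3 := by rw [div_le_iff₀ hs]; linarith
  have hq0 : 0 ≤ x / (1 - x) := by positivity
  have hi : x ^ 2 / (1 - x) ≤ 4 / 15 := by rw [div_le_iff₀ hs]; nlinarith
  have hi0 : 0 ≤ x ^ 2 / (1 - x) := by positivity
  have key := wds_lower Ld Lacc (Lh x) x (by linarith) ?_ ?_ k .B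
  · have h3 : ((wds Ld Lacc (k + 1) .B).card : ℝ) ≤ growth2 Rinf (k + 2) := by
      exact_mod_cast growth_Rinf_ge (k + 1)
    refine le_trans key ?_
    gcongr
  · intro s
    have h4 : (1 : ℝ) ≤ (wds Ld Lacc 1 s).card := by exact_mod_cast Ld_card_one s
    refine le_trans ?_ h4
    cases s <;> simp only [Lh]
    · linarith
    · nlinarith
    · linarith
    · linarith
    · linarith
  · intro s
    apply le_of_eq
    cases s <;> simp only [Ld, sum_sel, Option.elim_some, Option.elim_none, Lh] <;> field_simp <;> try ring_nf
    linarith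

noncomputable def Uh (n : ℕ) (x d : ℝ) : US → ℝ
  | .S => x * (1 + x / (1 - x) + (x / (1 - x) + d) + x * (x / (1 - x) + x ^ n * d))
  | .B => 1
  | .A => x / (1 - x)
  | .I => x * (x / (1 - x) + x ^ n * d)
  | .M r => x / (1 - x) * (1 - x ^ (r + 1))
  | .Q r => x / (1 - x) + x ^ r * d

theorem upper_bound (n : ℕ) {x : ℝ} (h1 : 0.3 ≤ x) (h2 : x ≤ 0.5)
    (hF : x * (1 + x / (1 - x) + x ^ 3 / ((1 - x) * ((1 - x) - x ^ (n + 2))) +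
      x / (1 - x) * (1 - x ^ (n + 2))) ≤ 1) :
    ∃ C : ℝ, 0 ≤ C ∧ ∀ k, (growth2 ((ROp)^[n] (LOp GSet)) k : ℝ) * x ^ k ≤ C := by
  have hx0 : 0 < x := by linarith
  have hs : 0 < 1 - x := by linarith
  have hxn : x ^ (n + 2) ≤ x ^ 2 := pow_le_pow_of_le_one hx0.le (by linarith) (by omega)
  have hD : 0 < (1 - x) - x ^ (n + 2) := by nlinarith
  set d := x ^ 3 / ((1 - x) * ((1 - x) - x ^ (n + 2))) with hd
  have hd0 : 0 ≤ d := by positivity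
  have hdeq : d * (1 - x) = x ^ 3 / (1 - x) + x ^ (n + 2) * d := by
    rw [hd]; field_simp; ring
  have hq : x ≤ x / (1 - x) := by rw [le_div_iff₀ hs]; nlinarith
  have hqeq : x / (1 - x) * (1 - x) = x := by field_simp
  set q := x / (1 - x) with hqdef
  have hq3 : x ^ 3 / (1 - x) = x ^ 2 * q := by rw [hqdef]; ring
  rw [hq3] at hdeq
  have hxx : x ^ 2 ≤ x := by nlinarith
  clear_value q d
  have key := fun k => wds_upper (Ud n) (fun _ => true) (Uh n x d) x (x ^ 2) hx0.le
    (by positivity) ?_ ?_ k .S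
  · refine ⟨Uh n x d .S / x ^ 2, ?_, ?_⟩
    · have : 0 ≤ q := by linarith
      simp only [Uh, ← hqdef]; positivity
    · intro k
      rw [le_div_iff₀ (by positivity)]
      refine le_trans ?_ (key k)
      have h3 : (growth2 ((ROp)^[n] (LOp GSet)) k : ℝ) ≤
          (wds (Ud n) (fun _ => true) k .S).card := by exact_mod_cast growth_RnL_le n k
      have : (growth2 ((ROp)^[n] (LOp GSet)) k : ℝ) * x ^ k * x ^ 2 =
        x ^ 2 * (growth2 ((ROp)^[n] (LOp GSet)) k : ℝ) * x ^ k := by ring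
      rw [this]
      gcongr
  · have hp : ∀ r, 0 ≤ x ^ r * d := fun r => by positivity
    intro s
    cases s <;> simp only [Uh, ← hqdef]
    · have := hp n
      have h5 : 0 ≤ x * (q + x ^ n * d) := mul_nonneg hx0.le (by linarith)
      nlinarith
    · nlinarith
    · linarith
    · have := hp n
      nlinarith
    · rename_i r
      have h6 : x ^ (r + 1) ≤ x := pow_le_of_le_one hx0.le (by linarith) (by omega)
      nlinarith
    · rename_i r
      have := hp r
      linarith
  · intro s
    rcases s with _ | _ | _ | _ | r | r
    · simp only [Ud, sum_sel, Option.elim_some, Option.elim_none, Uh, ← hqdef]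
      apply le_of_eq; ring
    · simp only [Ud, sum_sel, Option.elim_some, Option.elim_none, Uh, ← hqdef]
      refine le_trans (le_of_eq ?_) hF
      ring
    · simp only [Ud, sum_sel, Option.elim_some, Option.elim_none, Uh, ← hqdef]
      apply le_of_eq; linear_combination (-1) * hqeq
    · simp only [Ud, sum_sel, Option.elim_some, Option.elim_none, Uh, ← hqdef]
      apply le_of_eq; ring
    · cases r with
      | zero =>
        simp only [Ud, sum_sel, Option.elim_some, Option.elim_none, Uh, ← hqdef]
        apply le_of_eq; linear_combination (-1) * hqeq
      | succ r =>
        simp only [Ud, sum_sel, Option.elim_some, Option.elim_none, Uh, ← hqdef]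
        apply le_of_eq; linear_combination (-1) * hqeq
    · cases r with
      | zero =>
        simp only [Ud, sum_sel, Option.elim_some, Option.elim_none, Uh, ← hqdef]
        apply le_of_eq; linear_combination (-1) * hqeq - hdeq
      | succ r =>
        simp only [Ud, sum_sel, Option.elim_some, Option.elim_none, Uh, ← hqdef]
        apply le_of_eq; linear_combination (-1) * hqeq

theorem exists_x1 (n : ℕ) {x : ℝ} (h1 : 0.3 ≤ x) (h2 : x ≤ 0.4)
    (hx : 1 - 3 * x + x ^ 2 + x ^ 3 - x ^ 4 = 0) :
    ∃ y : ℝ, x < y ∧ y ≤ 0.5 ∧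
     y * (1 + y / (1 - y) + y ^ 3 / ((1 - y) * ((1 - y) - y ^ (n + 2))) +
      y / (1 - y) * (1 - y ^ (n + 2))) ≤ 1 := by
  have hx0 : 0 < x := by linarith
  have hs : 0 < 1 - x := by linarith
  have hxn : x ^ (n + 2) ≤ x ^ 2 := pow_le_pow_of_le_one hx0.le (by linarith) (by omega)
  have hD : 0 < (1 - x) - x ^ (n + 2) := by nlinarith
  have hcont : ContinuousAt (fun y : ℝ =>
     y * (1 + y / (1 - y) + y ^ 3 / ((1 - y) * ((1 - y) - y ^ (n + 2))) +
      y / (1 - y) * (1 - y ^ (n + 2)))) x := by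
    have e1 := hs.ne'
    have e2 := (mul_pos hs hD).ne'
    fun_prop (disch := assumption)
  have hlt : x * (1 + x / (1 - x) + x ^ 3 / ((1 - x) * ((1 - x) - x ^ (n + 2))) +
      x / (1 - x) * (1 - x ^ (n + 2))) < 1 := by
    have hz : 0 < x ^ (n + 2) := by positivity
    set z := x ^ (n + 2)
    have hbase : x * (1 + 2 * (x / (1 - x)) + x ^ 3 / (1 - x) ^ 2) = 1 := by
      field_simp; linarith
    have hmain : x ^ 3 / ((1 - x) * ((1 - x) - z)) < x ^ 3 / (1 - x) ^ 2 + x / (1 - x) * z := by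
      have : x ^ 3 / (1 - x) ^ 2 + x / (1 - x) * z - x ^ 3 / ((1 - x) * ((1 - x) - z)) =
        x * z * ((1 - x) * ((1 - x) - z) - x ^ 2) / ((1 - x) ^ 2 * ((1 - x) - z)) := by
        field_simp; ring
      have h5 : 0 < (1 - x) * ((1 - x) - z) - x ^ 2 := by nlinarith
      have h6 : 0 < x * z * ((1 - x) * ((1 - x) - z) - x ^ 2) / ((1 - x) ^ 2 * ((1 - x) - z)) := by
        positivity
      linarith
    nlinarith
  have hev := hcont.eventually_lt_const hlt
  have hev2 : ∀ᶠ y in nhds x, y < (0.5 : ℝ) := eventually_lt_nhds (by norm_num at h2 ⊢; linarith)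
  obtain ⟨ε, hε, hball⟩ := Metric.eventually_nhds_iff.1 (hev.and hev2)
  have := @hball (x + ε / 2) (by rw [Real.dist_eq]; rw [abs_of_pos] <;> linarith)
  exact ⟨x + ε / 2, by linarith, this.2.le, this.1.le⟩

theorem RnL_negligible_in_Rinf (n : ℕ) :
    Filter.Tendsto
      (fun k : ℕ => (growth2 ((ROp)^[n] (LOp GSet)) k : ℝ) / (growth2 Rinf k : ℝ))
      Filter.atTop (nhds 0) := by

  obtain ⟨x, h1, h2, hx⟩ := exists_root
  obtain ⟨y, hxy, hy, hF⟩ := exists_x1 n h1 h2 hx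
  obtain ⟨C, hC, hU⟩ := upper_bound n (by linarith) hy hF
  have hL := fun k => lower_bound h1 h2 hx k
  have hx0 : 0 < x := by linarith
  have hy0 : 0 < y := by linarith
  have hr : x / y < 1 := (div_lt_one hy0).2 hxy
  have hlim : Filter.Tendsto (fun k : ℕ => C / x ^ 2 * (x / y) ^ k) Filter.atTop (nhds 0) := by
    have := (tendsto_pow_atTop_nhds_zero_of_lt_one (by positivity : 0 ≤ x / y) hr).const_mul
      (C / x ^ 2)
    simpa using this
  refine tendsto_of_tendsto_of_tendsto_of_le_of_le' tendsto_const_nhds hlim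
    (Filter.Eventually.of_forall fun k => by positivity) ?_
  filter_upwards [Filter.eventually_ge_atTop 2] with k hk
  obtain ⟨m, rfl⟩ : ∃ m, k = m + 2 := ⟨k - 2, by omega⟩
  have hu := hU (m + 2)
  have hl := hL m
  set u : ℝ := (growth2 ((ROp)^[n] (LOp GSet)) (m + 2) : ℝ)
  set v : ℝ := (growth2 Rinf (m + 2) : ℝ)
  have hv : 0 < v := by
    by_contra hv
    have : v * x ^ m ≤ 0 := mul_nonpos_of_nonpos_of_nonneg (by linarith) (by positivity)
    linarith
  rw [div_le_iff₀ hv, div_pow]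
  have hym : 0 < y ^ (m + 2) := by positivity
  have e : C / x ^ 2 * (x ^ (m + 2) / y ^ (m + 2)) * v = C * (v * x ^ m) / y ^ (m + 2) := by
    rw [pow_add x m 2]; field_simp
  rw [e, le_div_iff₀ hym]
  nlinarith
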